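/- arXiv:2509.06123 — 4 statements merged into one kernel-verified Lean document; each statement's English description precedes it below -/
import Mathlib

section
/- Let g : ℕ → ℤ be a normalized arithmetic function (g(1) = 1) with g(3) ≡ 0 or 1 (mod 3). Let m ≥ 3 and let ζ be a primitive m-th root of unity in ℂ. Then for all n ≥ 1, P_n^g(ζ) ≠ 0 (evaluation of the rational polynomial P_n^g at ζ via the algebra map ℚ → ℂ). -/
open Polynomial

/-- The polynomials `P_n^g ∈ ℚ[X]` defined by `P_0^g = 1` and
`P_n^g = (x/n) ∑_{k=1}^n g(k) P_{n-k}^g` for `n ≥ 1`. -/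
noncomputable def darcais (g : ℕ → ℤ) : ℕ → ℚ[X]
  | 0 => 1
  | n + 1 =>
      C (((n : ℚ) + 1)⁻¹) * X *
        ∑ k ∈ Finset.range (n + 1), C ((g (k + 1) : ℚ)) * darcais g (n - k)
  decreasing_by exact Nat.sub_lt_succ n k

/-- `A_n^g := n! ⬝ P_n^g`. -/
noncomputable def darcaisA (g : ℕ → ℤ) (n : ℕ) : ℚ[X] :=
  (n.factorial : ℚ[X]) * darcais g n

/-- Sum-of-divisors function `σ` as a `ℤ`-valued arithmetic function. -/
def sigma' (n : ℕ) : ℤ := ∑ d ∈ n.divisors, (d : ℤ)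

/-- Integral model of `darcaisA`, given by the recursion with denominators cleared. -/
noncomputable def darcaisInt (g : ℕ → ℤ) : ℕ → ℤ[X]
  | 0 => 1
  | n + 1 =>
      X * ∑ k ∈ Finset.range (n + 1),
        C (g (k + 1) * (n.descFactorial k : ℤ)) * darcaisInt g (n - k)
  decreasing_by exact Nat.sub_lt_succ n k

theorem map_darcaisInt (g : ℕ → ℤ) (n : ℕ) :
    (darcaisInt g n).map (Int.castRingHom ℚ) = darcaisA g n := by
  induction n using Nat.strong_induction_on with
  | _ n ih =>
    cases n with
    | zero => simp [darcaisInt, darcaisA, darcais]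
    | succ n =>
      have key : ∀ k ∈ Finset.range (n + 1),
          (C (g (k + 1) * (n.descFactorial k : ℤ)) * darcaisInt g (n - k)).map
            (Int.castRingHom ℚ) = (n.factorial : ℚ[X]) *
              (C ((g (k + 1) : ℚ)) * darcais g (n - k)) := by
        intro k hk
        rw [Polynomial.map_mul, ih (n - k) (by omega), darcaisA,
          ← Nat.factorial_mul_descFactorial (Finset.mem_range_succ_iff.mp hk)]
        simp
        ring
      have hn : C (((n : ℚ) + 1)⁻¹) * ((n : ℚ[X]) + 1) = 1 := by
        have : ((n : ℚ[X]) + 1) = C ((n : ℚ) + 1) := by simp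
        rw [this, ← C_mul, inv_mul_cancel₀ (by positivity), C_1]
      rw [darcaisInt, darcaisA, darcais, Polynomial.map_mul, Polynomial.map_sum,
        Finset.sum_congr rfl key, ← Finset.mul_sum, Nat.factorial_succ, map_X]
      push_cast
      linear_combination (-(X * (n.factorial : ℚ[X]) *
        ∑ k ∈ Finset.range (n + 1), C ((g (k + 1) : ℚ)) * darcais g (n - k))) * hn

/-- In characteristic `p` only the first `p` terms of the recursion survive. -/
theorem aeval_darcaisInt_succ {K : Type*} [CommRing K] (p : ℕ) [CharP K p] (hp : p.Prime)
    (g : ℕ → ℤ) (x : K) (n : ℕ) :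
    aeval x (darcaisInt g (n + 1)) = x * ∑ k ∈ Finset.range p,
      (g (k + 1) : K) * (n.descFactorial k : K) * aeval x (darcaisInt g (n - k)) := by
  have hvanish : ∀ k, n < k ∨ p ≤ k → (n.descFactorial k : K) = 0 := by
    rintro k (h | h)
    · simp [Nat.descFactorial_of_lt h]
    · rw [CharP.cast_eq_zero_iff K p]
      exact ((hp.dvd_factorial).mpr h).trans (Nat.factorial_dvd_descFactorial n k)
  rw [darcaisInt, map_mul, aeval_X, map_sum]
  congr 1
  trans ∑ k ∈ Finset.range (n + 1 + p),
    (g (k + 1) : K) * (n.descFactorial k : K) * aeval x (darcaisInt g (n - k))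
  · rw [← Finset.sum_subset (Finset.range_mono (Nat.le_add_right (n + 1) p))]
    · simp
    · intro k _ hk
      rw [hvanish k (Or.inl (by simpa using hk))]
      ring
  · symm
    apply Finset.sum_subset (Finset.range_mono (Nat.le_add_left p (n + 1)))
    intro k _ hk
    rw [hvanish k (Or.inr (by simpa using hk))]
    ring

theorem pow_sub_one_eq_one_of_add_intCast_eq_zero {K : Type*} [Field K] (p : ℕ)
    [hp : Fact p.Prime] [CharP K p] {x : K} (hx : x ≠ 0) {a : ℤ} (h : x + a = 0) :
    x ^ (p - 1) = 1 := by
  have hxa : x = ((-a : ℤ) : K) := by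
    push_cast
    linear_combination h
  have hfrob : x ^ p = x := by
    rw [← frobenius_def, hxa, map_intCast]
  have hpow : x ^ (p - 1) * x = 1 * x := by
    rw [← pow_succ, Nat.sub_add_cancel hp.out.one_le, hfrob, one_mul]
  exact mul_right_cancel₀ hx hpow

theorem aeval_darcaisInt_ne_zero_of_char_two {K : Type*} [Field K] [CharP K 2]
    {g : ℕ → ℤ} (hg1 : g 1 = 1) {x : K} (hx : x ≠ 0) (hx1 : x ^ (2 - 1) ≠ 1) (n : ℕ) :
    aeval x (darcaisInt g n) ≠ 0 := by
  have h2 : (2 : K) = 0 := CharP.cast_eq_zero K 2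
  have hg2 : x + (g 2 : K) ≠ 0 := fun h =>
    hx1 (pow_sub_one_eq_one_of_add_intCast_eq_zero 2 hx h)
  have rec_one (k : ℕ) : aeval x (darcaisInt g (2 * k + 1)) =
      x * aeval x (darcaisInt g (2 * k)) := by
    rw [aeval_darcaisInt_succ 2 Nat.prime_two]
    simp [Finset.sum_range_succ, hg1, h2]
  have rec_two (k : ℕ) : aeval x (darcaisInt g (2 * k + 2)) =
      x * (x + g 2) * aeval x (darcaisInt g (2 * k)) := by
    rw [aeval_darcaisInt_succ 2 Nat.prime_two]
    simp [Finset.sum_range_succ, hg1, h2, rec_one]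
    ring
  have even_ne_zero (k : ℕ) : aeval x (darcaisInt g (2 * k)) ≠ 0 := by
    induction k with
    | zero => simp [darcaisInt]
    | succ k ih =>
      rw [Nat.mul_succ, rec_two]
      exact mul_ne_zero (mul_ne_zero hx hg2) ih
  obtain ⟨k, rfl | rfl⟩ := Nat.even_or_odd' n
  · exact even_ne_zero k
  · rw [rec_one]
    exact mul_ne_zero hx (even_ne_zero k)

theorem aeval_darcaisInt_ne_zero_of_char_three {K : Type*} [Field K] [CharP K 3]
    {g : ℕ → ℤ} (hg1 : g 1 = 1) (hg3 : g 3 % 3 = 0 ∨ g 3 % 3 = 1)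
    {x : K} (hx : x ≠ 0) (hx1 : x ^ (3 - 1) ≠ 1) (n : ℕ) :
    aeval x (darcaisInt g n) ≠ 0 := by
  have h3 : (3 : K) = 0 := CharP.cast_eq_zero K 3
  have hg2 : x + (g 2 : K) ≠ 0 := fun h =>
    hx1 (pow_sub_one_eq_one_of_add_intCast_eq_zero 3 hx h)
  have hg3' : x ^ 2 - (g 3 : K) ≠ 0 := by
    have hdiv : (g 3 : K) = ((g 3 % 3 : ℤ) : K) := by
      conv_lhs => rw [← Int.emod_add_mul_ediv (g 3) 3]
      push_cast
      rw [h3]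
      ring
    rcases hg3 with h | h
    · simp [hdiv, h, hx]
    · simpa [hdiv, h, sub_eq_zero] using hx1
  have rec_one (k : ℕ) : aeval x (darcaisInt g (3 * k + 1)) =
      x * aeval x (darcaisInt g (3 * k)) := by
    rw [aeval_darcaisInt_succ 3 Nat.prime_three]
    simp [Finset.sum_range_succ, hg1, h3, Nat.descFactorial_succ]
  have rec_two (k : ℕ) : aeval x (darcaisInt g (3 * k + 2)) =
      x * (x + g 2) * aeval x (darcaisInt g (3 * k)) := by
    rw [aeval_darcaisInt_succ 3 Nat.prime_three]
    simp [Finset.sum_range_succ, hg1, h3, rec_one, Nat.descFactorial_succ]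
    ring
  have rec_three (k : ℕ) : aeval x (darcaisInt g (3 * k + 3)) =
      x * (x ^ 2 - g 3) * aeval x (darcaisInt g (3 * k)) := by
    rw [aeval_darcaisInt_succ 3 Nat.prime_three]
    simp [Finset.sum_range_succ, hg1, h3, rec_one, rec_two, Nat.descFactorial_succ]
    linear_combination (x * aeval x (darcaisInt g (3 * k)) * (g 2 * x + g 3)) * h3
  have mul_three_ne_zero (k : ℕ) : aeval x (darcaisInt g (3 * k)) ≠ 0 := by
    induction k with
    | zero => simp [darcaisInt]
    | succ k ih =>
      rw [Nat.mul_succ, rec_three]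
      exact mul_ne_zero (mul_ne_zero hx hg3') ih
  obtain ⟨k, rfl | rfl | rfl⟩ : ∃ k, n = 3 * k ∨ n = 3 * k + 1 ∨ n = 3 * k + 2 :=
    ⟨n / 3, by omega⟩
  · exact mul_three_ne_zero k
  · rw [rec_one]
    exact mul_ne_zero hx (mul_three_ne_zero k)
  · rw [rec_two]
    exact mul_ne_zero (mul_ne_zero hx hg2) (mul_three_ne_zero k)

/-- If an integral polynomial vanishes at a primitive `p ^ k * m`-th root of unity in `ℂ` with
`p ∤ m`, then it vanishes at some primitive `m`-th root of unity in characteristic `p`. -/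
theorem exists_isPrimitiveRoot_aeval_eq_zero (p : ℕ) [Fact p.Prime] {k m : ℕ}
    (hpm : ¬ p ∣ m) {ζ : ℂ} (hζ : IsPrimitiveRoot ζ (p ^ k * m)) {f : ℤ[X]}
    (hf : aeval ζ f = 0) :
    ∃ x : AlgebraicClosure (ZMod p), IsPrimitiveRoot x m ∧ aeval x f = 0 := by
  have hm : 0 < m := Nat.pos_of_ne_zero fun h => hpm (h ▸ dvd_zero p)
  have hpos : 0 < p ^ k * m := Nat.mul_pos (pow_pos (Fact.out : p.Prime).pos k) hm
  have : CharP (AlgebraicClosure (ZMod p)) p := charP_of_injective_algebraMap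
    (algebraMap (ZMod p) (AlgebraicClosure (ZMod p))).injective p
  have : NeZero (m : AlgebraicClosure (ZMod p)) :=
    ⟨fun h => hpm ((CharP.cast_eq_zero_iff _ p m).mp h)⟩
  have hdvd : cyclotomic (p ^ k * m) ℤ ∣ f := by
    rw [cyclotomic_eq_minpoly hζ hpos]
    exact minpoly.isIntegrallyClosed_dvd (hζ.isIntegral hpos) hf
  obtain ⟨x, hx⟩ := IsAlgClosed.exists_root
    (cyclotomic (p ^ k * m) (AlgebraicClosure (ZMod p)))
    (degree_cyclotomic_pos _ _ hpos).ne'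
  refine ⟨x, isRoot_cyclotomic_prime_pow_mul_iff_of_charP.mp hx, ?_⟩
  obtain ⟨q, rfl⟩ := hdvd
  have hroot : aeval x (cyclotomic (p ^ k * m) ℤ) = 0 := by
    rw [aeval_def, ← eval_map, map_cyclotomic]
    exact hx
  rw [map_mul, hroot, zero_mul]

/-- Theorem 3 (Heim–Neuhauser): if `g(1) = 1` and `g(3) ≡ 0, 1 (mod 3)`, then for every
`m ≥ 3`, every primitive `m`-th root of unity `ζ ∈ ℂ`, and every `n ≥ 1`,
we have `P_n^g(ζ) ≠ 0`. -/
theorem darcais_ne_zero_at_primitive_root (g : ℕ → ℤ) (hg1 : g 1 = 1)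
    (hg3 : g 3 % 3 = 0 ∨ g 3 % 3 = 1)
    (m : ℕ) (hm : 3 ≤ m) (ζ : ℂ) (hζ : IsPrimitiveRoot ζ m)
    (n : ℕ) (hn : 1 ≤ n) :
    aeval ζ (darcais g n) ≠ 0 := by
  intro h
  have hf : aeval ζ (darcaisInt g n) = 0 := by
    have hmap : aeval ζ ((darcaisInt g n).map (Int.castRingHom ℚ)) = 0 := by
      rw [map_darcaisInt, darcaisA, map_mul, h, mul_zero]
    rwa [← algebraMap_int_eq, aeval_map_algebraMap] at hmap
  have hm0 : m ≠ 0 := by omega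
  obtain ⟨i, a, ha, hma⟩ := Nat.exists_eq_pow_mul_and_not_dvd hm0 2 (by norm_num)
  obtain ⟨j, b, hb, hmb⟩ := Nat.exists_eq_pow_mul_and_not_dvd hm0 3 (by norm_num)
  have ha1 : a ∣ 1 := by
    have : CharP (AlgebraicClosure (ZMod 2)) 2 := charP_of_injective_algebraMap
      (algebraMap (ZMod 2) (AlgebraicClosure (ZMod 2))).injective 2
    obtain ⟨x, hx, hfx⟩ := exists_isPrimitiveRoot_aeval_eq_zero 2 ha (hma ▸ hζ) hf
    by_contra hdvd
    exact aeval_darcaisInt_ne_zero_of_char_two hg1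
      (hx.ne_zero (by rintro rfl; simp at ha))
      (fun hpow => hdvd (hx.dvd_of_pow_eq_one _ hpow)) n hfx
  have hb2 : b ∣ 2 := by
    have : CharP (AlgebraicClosure (ZMod 3)) 3 := charP_of_injective_algebraMap
      (algebraMap (ZMod 3) (AlgebraicClosure (ZMod 3))).injective 3
    obtain ⟨x, hx, hfx⟩ := exists_isPrimitiveRoot_aeval_eq_zero 3 hb (hmb ▸ hζ) hf
    by_contra hdvd
    exact aeval_darcaisInt_ne_zero_of_char_three hg1 hg3
      (hx.ne_zero (by rintro rfl; simp at hb))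
      (fun hpow => hdvd (hx.dvd_of_pow_eq_one _ hpow)) n hfx
  have hm2 : m = 2 ^ i := by rw [hma, Nat.dvd_one.mp ha1, mul_one]
  have hj : 3 ^ j = 1 := by
    have hcop : Nat.Coprime (3 ^ j) (2 ^ i) := Nat.Coprime.pow j i (by norm_num)
    exact hcop.eq_one_of_dvd (hm2 ▸ ⟨b, hmb⟩)
  have hle := Nat.le_of_dvd two_pos hb2
  rw [hj, one_mul] at hmb
  omega
end

section
/- Let g : ℕ → ℤ be a normalized arithmetic function (g(1) = 1) and let A_n^g(x) := n! · P_n^g(x). Then A_n^g(x) ∈ ℤ[x] and for all n ≥ 1, A_n^g(x) = x · Σ_{k=1}^n ((n−1)!/(n−k)!) · g(k) · A_{n-k}^g(x). -/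
open Polynomial

theorem darcaisA_succ (g : ℕ → ℤ) (m : ℕ) :
    darcaisA g (m + 1) = X * ∑ k ∈ Finset.range (m + 1),
      C (((m.factorial / (m - k).factorial : ℕ) : ℚ)) * C ((g (k + 1) : ℚ)) *
        darcaisA g (m - k) := by
  have hfac : (((m + 1).factorial : ℕ) : ℚ[X]) * C (((m : ℚ) + 1)⁻¹) = C (m.factorial : ℚ) := by
    have hm : (m : ℚ) + 1 ≠ 0 := by positivity
    rw [← C_eq_natCast, ← C_mul, Nat.factorial_succ]
    congr 1
    push_cast
    field_simp
  rw [darcaisA, darcais, ← mul_assoc, ← mul_assoc, hfac, mul_comm (C _) X, mul_assoc,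
    Finset.mul_sum]
  congr 1
  refine Finset.sum_congr rfl fun k _ => ?_
  have hdiv : C (m.factorial : ℚ) =
      C (((m.factorial / (m - k).factorial : ℕ) : ℚ)) * ((m - k).factorial : ℚ[X]) := by
    rw [← C_eq_natCast, ← C_mul, ← Nat.cast_mul,
      Nat.div_mul_cancel (Nat.factorial_dvd_factorial (Nat.sub_le m k))]
  rw [hdiv, darcaisA]
  ring

theorem darcaisA_mem_lifts (g : ℕ → ℤ) (n : ℕ) :
    darcaisA g n ∈ Polynomial.lifts (Int.castRingHom ℚ) := by
  induction n using Nat.strong_induction_on with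
  | _ n ih =>
    cases n with
    | zero =>
      simp only [darcaisA, darcais, Nat.factorial_zero, Nat.cast_one, mul_one]
      exact one_mem _
    | succ m =>
      rw [darcaisA_succ]
      refine mul_mem (X_mem_lifts _) (sum_mem fun k _ => mul_mem (mul_mem ?_ ?_) ?_)
      · simp
      · exact C_mem_lifts (Int.castRingHom ℚ) (g (k + 1))
      · exact ih _ (Nat.sub_lt_succ m k)

/-- If `g(1) = 1` then `A_n^g := n! ⬝ P_n^g` has integer coefficients, and for `n ≥ 1`
it satisfies the recursion `A_n^g(x) = x ∑_{k=1}^n ((n-1)!/(n-k)!) g(k) A_{n-k}^g(x)`. -/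
theorem darcaisA_lifts_and_recursion (g : ℕ → ℤ) (hg1 : g 1 = 1) (n : ℕ) :
    darcaisA g n ∈ Polynomial.lifts (Int.castRingHom ℚ) ∧
    (1 ≤ n → darcaisA g n = X * ∑ k ∈ Finset.Icc 1 n,
      C ((((n - 1).factorial / (n - k).factorial : ℕ) : ℚ)) * C ((g k : ℚ)) *
        darcaisA g (n - k)) := by
  refine ⟨darcaisA_mem_lifts g n, fun hn => ?_⟩
  obtain ⟨m, rfl⟩ := Nat.exists_eq_add_of_le' hn
  rw [darcaisA_succ, ← Finset.Ico_add_one_right_eq_Icc, Finset.sum_Ico_eq_sum_range]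
  simp only [Nat.add_sub_cancel, add_comm 1, Nat.add_sub_add_right]
end

section
/- Let g : ℕ → ℤ be a normalized arithmetic function (g(1) = 1) such that P_n^g(x) is an integer-valued polynomial for all n ≥ 1, let A_n^g(x) := n! · P_n^g(x) ∈ ℤ[x], and let p be a prime. Then the reduction of A_p^g modulo p satisfies A_p^g(x) ≡ x(x−1)(x−2)⋯(x−p+1) in 𝔽_p[x]. -/
open Polynomial

theorem natDegree_darcais_le (g : ℕ → ℤ) (n : ℕ) : (darcais g n).natDegree ≤ n := by
  induction n using Nat.strong_induction_on with
  | _ n ih =>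
    cases n with
    | zero => simp [darcais]
    | succ n =>
      rw [darcais, mul_assoc]
      refine (natDegree_C_mul_le _ _).trans (natDegree_mul_le.trans ?_)
      rw [natDegree_X, add_comm]
      gcongr
      refine natDegree_sum_le_of_forall_le _ _ fun k _ => (natDegree_C_mul_le _ _).trans ?_
      exact (ih (n - k) (by omega)).trans (Nat.sub_le n k)

theorem coeff_darcais_self (g : ℕ → ℤ) (hg1 : g 1 = 1) (n : ℕ) :
    (darcais g n).coeff n = ((n.factorial : ℚ))⁻¹ := by
  induction n with
  | zero => simp [darcais]
  | succ n ih =>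
    rw [darcais, mul_assoc, coeff_C_mul, coeff_X_mul, finsetSum_coeff,
      Finset.sum_eq_single_of_mem 0 (by simp)]
    · simp [hg1, ih, Nat.factorial_succ, mul_comm]
    · intro k hk hk0
      have hkn := Finset.mem_range.mp hk
      rw [coeff_C_mul, coeff_eq_zero_of_natDegree_lt, mul_zero]
      exact (natDegree_darcais_le g (n - k)).trans_lt (by omega)

theorem darcaisA_eq_C_mul (g : ℕ → ℤ) (n : ℕ) :
    darcaisA g n = C (n.factorial : ℚ) * darcais g n := by
  rw [darcaisA, C_eq_natCast]

theorem natDegree_darcaisA_le (g : ℕ → ℤ) (n : ℕ) : (darcaisA g n).natDegree ≤ n := by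
  rw [darcaisA_eq_C_mul]
  exact (natDegree_C_mul_le _ _).trans (natDegree_darcais_le g n)

theorem coeff_darcaisA_self (g : ℕ → ℤ) (hg1 : g 1 = 1) (n : ℕ) :
    (darcaisA g n).coeff n = 1 := by
  rw [darcaisA_eq_C_mul, coeff_C_mul, coeff_darcais_self g hg1]
  exact mul_inv_cancel₀ (mod_cast n.factorial_ne_zero)

/-- A monic polynomial of degree `p` over `𝔽_p` vanishing everywhere is `x(x-1)⋯(x-p+1)`. -/
theorem eq_prod_range_X_sub_C_of_eval_eq_zero {p : ℕ} [Fact p.Prime] {f : (ZMod p)[X]}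
    (hf : f.Monic) (hdeg : f.natDegree = p) (hroot : ∀ x, f.eval x = 0) :
    f = ∏ j ∈ Finset.range p, (X - C ((j : ZMod p))) := by
  have hmonic : (∏ j ∈ Finset.range p, (X - C ((j : ZMod p)))).Monic :=
    monic_prod_of_monic _ _ fun j _ => monic_X_sub_C _
  have hfdeg : f.degree = p := by rw [degree_eq_natDegree hf.ne_zero, hdeg]
  refine eq_of_degree_le_of_eval_finset_eq Finset.univ ?_ ?_ ?_ fun x _ => ?_
  · rw [hfdeg, Finset.card_univ, ZMod.card]
  · rw [hfdeg, degree_prod]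
    simp only [degree_X_sub_C]
    simp
  · rw [hf.leadingCoeff, hmonic.leadingCoeff]
  · rw [hroot, eval_prod, eq_comm]
    exact Finset.prod_eq_zero (Finset.mem_range.mpr x.val_lt) (by simp)

/-- Lemma 6, second part: if `g(1) = 1`, all `P_n^g` are integer-valued polynomials,
and `p` is prime, then the reduction of `A_p^g` mod `p` equals
`x(x-1)(x-2)⋯(x-p+1)` in `𝔽_p[x]`. -/
theorem darcaisA_p_reduction (g : ℕ → ℤ) (hg1 : g 1 = 1)
    (hint : ∀ n : ℕ, 1 ≤ n → ∀ k : ℤ, ∃ z : ℤ, (darcais g n).eval (k : ℚ) = (z : ℚ))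
    (p : ℕ) (hp : p.Prime)
    (B : ℤ[X]) (hB : B.map (Int.castRingHom ℚ) = darcaisA g p) :
    B.map (Int.castRingHom (ZMod p)) =
      ∏ j ∈ Finset.range p, (X - C ((j : ZMod p))) := by
  have : Fact p.Prime := ⟨hp⟩
  have hinj : Function.Injective (Int.castRingHom ℚ) := Int.cast_injective
  have hle : B.natDegree ≤ p := by
    rw [← natDegree_map_eq_of_injective hinj, hB]
    exact natDegree_darcaisA_le g p
  have hcoeff : B.coeff p = 1 := by
    apply hinj
    rw [← coeff_map, hB, coeff_darcaisA_self g hg1, map_one]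
  have hmonic : B.Monic := monic_of_natDegree_le_of_coeff_eq_one p hle hcoeff
  have hdeg : B.natDegree = p :=
    hle.antisymm (le_natDegree_of_ne_zero (by rw [hcoeff]; exact one_ne_zero))
  refine eq_prod_range_X_sub_C_of_eval_eq_zero (hmonic.map _)
    ((hmonic.natDegree_map _).trans hdeg) fun x => ?_
  obtain ⟨k, rfl⟩ := ZMod.intCast_surjective x
  obtain ⟨z, hz⟩ := hint p hp.one_le k
  have heval : B.eval k = p.factorial * z := by
    have h : (B.map (Int.castRingHom ℚ)).eval (k : ℚ) = p.factorial * z := by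
      rw [hB, darcaisA_eq_C_mul, eval_mul, eval_C, hz]
    rw [eval_intCast_map, eq_intCast] at h
    exact_mod_cast h
  have hfact : ((p.factorial : ℕ) : ZMod p) = 0 :=
    (ZMod.natCast_eq_zero_iff _ _).mpr (Nat.dvd_factorial hp.pos le_rfl)
  rw [eval_intCast_map, Int.cast_id, heval]
  simp [hfact]
end

section
/- For every n ≥ 1, P_n^σ(−1/2) ≠ 0; that is, the n-th coefficient of the q-expansion of ∏_{k=1}^∞ (1 − q^k)^{1/2}, which equals the rational number P_n^σ(−1/2), is non-vanishing for all n. -/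
open Polynomial

/-- If `g 1 = 1`, then `2 ^ n * n! * P_n^g(-1/2)` is an odd integer. -/
theorem exists_odd_eq_two_pow_mul_factorial_mul_darcais_eval {g : ℕ → ℤ} (hg : g 1 = 1) (n : ℕ) :
    ∃ z : ℤ, Odd z ∧
      (2 : ℚ) ^ n * n.factorial * (darcais g n).eval (-(1 / 2) : ℚ) = z := by
  induction n using Nat.strong_induction_on with
  | _ n ih =>
    cases n with
    | zero => exact ⟨1, odd_one, by simp [darcais]⟩
    | succ n =>
      choose! z hodd hz using ih
      refine ⟨-∑ k ∈ Finset.range (n + 1), g (k + 1) * 2 ^ k * n.descFactorial k * z (n - k),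
        ?_, ?_⟩
      · rw [Finset.sum_range_succ']
        refine (Even.add_odd (Finset.even_sum _ fun k _ => ?_) ?_).neg
        · rw [pow_succ]
          exact even_iff_two_dvd.mpr ⟨g (k + 1 + 1) * 2 ^ k * n.descFactorial (k + 1) *
            z (n - (k + 1)), by ring⟩
        · simpa [hg] using hodd n n.lt_succ_self
      · have hn : (n : ℚ) + 1 ≠ 0 := by positivity
        rw [darcais]
        simp only [eval_mul, eval_C, eval_X, eval_finsetSum, Nat.factorial_succ]
        push_cast
        rw [Finset.mul_sum, Finset.mul_sum, ← Finset.sum_neg_distrib]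
        refine Finset.sum_congr rfl fun k hk => ?_
        have hk : k ≤ n := Nat.lt_succ_iff.mp (Finset.mem_range.mp hk)
        rw [← hz (n - k) (by omega), ← Nat.factorial_mul_descFactorial hk,
          show (2 : ℚ) ^ (n + 1) = 2 ^ k * 2 ^ (n - k) * 2 by
            rw [← pow_add, Nat.add_sub_cancel' hk, pow_succ]]
        push_cast
        field_simp

/-- For every `n ≥ 1`, `P_n^σ(-1/2) ≠ 0`: the `n`-th coefficient of the `q`-expansion
of `∏_{k=1}^∞ (1 - q^k)^{1/2}`, which equals the rational number `P_n^σ(-1/2)`,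
is non-vanishing. -/
theorem darcaisSigma_eval_neg_half_ne_zero (n : ℕ) (hn : 1 ≤ n) :
    (darcais sigma' n).eval (-(1 / 2) : ℚ) ≠ 0 := by
  intro h
  obtain ⟨z, hodd, hz⟩ :=
    exists_odd_eq_two_pow_mul_factorial_mul_darcais_eval (g := sigma') (by simp [sigma']) n
  rw [h, mul_zero, eq_comm, Int.cast_eq_zero] at hz
  simp [hz] at hodd
end
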